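/- Let n ≥ 2 and let r, s ≥ 0 be integers with 1 ≤ r+s ≤ n−1. If χ and χ̄ are real symmetric (n−1)×(n−1) matrices both lying in the Gårding cone Γ_{r+s}, then P_{r,s}(χ,χ̄) > 0. -/

import Mathlib

open Matrix

/-- `sigmaM k W` is the `k`-th elementary symmetric function of (the eigenvalues of) `W`,
defined as the coefficient of `x^k` in `det (I + x • W)`. -/
noncomputable def sigmaM {m : ℕ} {R : Type*} [CommRing R] (k : ℕ)
    (W : Matrix (Fin m) (Fin m) R) : R :=
  ((1 + (Polynomial.X : Polynomial R) • W.map Polynomial.C).det).coeff k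

/-- The mixed higher order mean curvature `P_{r,s}(χ, χ̄)`, defined as
`(r! s! / (r+s)!)` times the coefficient of `y^r ȳ^s` in `det (I + y • χ + ȳ • χ̄)`. -/
noncomputable def mixedP {m : ℕ} (r s : ℕ) (χ χb : Matrix (Fin m) (Fin m) ℝ) : ℝ :=
  ((Nat.factorial r * Nat.factorial s : ℝ) / (Nat.factorial (r + s) : ℝ)) *
    ((((1 : Matrix (Fin m) (Fin m) (Polynomial (Polynomial ℝ)))
        + (Polynomial.X : Polynomial (Polynomial ℝ)) •
            χ.map (fun a => Polynomial.C (Polynomial.C a))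
        + (Polynomial.C Polynomial.X : Polynomial (Polynomial ℝ)) •
            χb.map (fun a => Polynomial.C (Polynomial.C a))).det).coeff r).coeff s

/-- A real symmetric matrix lies in the Gårding cone `Γ_k` iff the elementary symmetric
functions `σ_1, …, σ_k` of its eigenvalues are all positive. -/
def matGamma {m : ℕ} (k : ℕ) (W : Matrix (Fin m) (Fin m) ℝ) : Prop :=
  ∀ j : ℕ, 1 ≤ j → j ≤ k → 0 < sigmaM j W

open Polynomial in
theorem sq_splits_comb (P : ℝ[X]) (hP : P.Splits) (α β : ℝ) (hβ : β ≠ 0) :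
    (C α * P + C β * derivative P).Splits := by
  by_cases h0 : P.natDegree = 0
  · rw [Polynomial.eq_C_of_natDegree_eq_zero h0]
    simp only [derivative_C, mul_zero, add_zero, ← C_mul]
    exact Splits.C _
  have hP0 : P ≠ 0 := by rintro rfl; simp at h0
  apply Splits.of_splits_map (Complex.ofRealHom) (IsAlgClosed.splits _)
  intro x hx
  by_contra hr
  have him : x.im ≠ 0 := by
    intro h
    exact hr ⟨x.re, by apply Complex.ext <;> simp [h]⟩
  have hroot := isRoot_of_mem_roots hx
  set Q := P.map Complex.ofRealHom with hQ
  have hQs : Q.Splits := hP.map _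
  have hQr : Q.roots = P.roots.map Complex.ofRealHom := hP.roots_map _
  have hQ0 : Q ≠ 0 := (Polynomial.map_ne_zero_iff (RingHom.injective _)).2 hP0
  have hQx : Q.eval x ≠ 0 := by
    intro h
    have : x ∈ Q.roots := (mem_roots hQ0).2 h
    rw [hQr, Multiset.mem_map] at this
    obtain ⟨a, _, rfl⟩ := this
    exact hr ⟨a, rfl⟩
  have hsum := hQs.eval_derivative_eq_eval_mul_sum hQx
  have h1 : (α : ℂ) * Q.eval x + β * (derivative Q).eval x = 0 := by
    have := hroot
    simp only [IsRoot, Polynomial.map_add, Polynomial.map_mul, map_C, eval_add, eval_mul, eval_C,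
      ← derivative_map] at this
    simpa [hQ] using this
  rw [hsum] at h1
  set S := (Q.roots.map fun z ↦ 1 / (x - z)).sum with hS
  have h2 : (α : ℂ) + β * S = 0 := by
    apply mul_left_cancel₀ hQx
    linear_combination h1
  have h3 : S.im = 0 := by
    have := congrArg Complex.im h2
    simpa [hβ] using this
  have h4 : S.im = -x.im * (P.roots.map fun z : ℝ => 1 / Complex.normSq (x - z)).sum := by
    rw [hS, hQr, Multiset.map_map]
    have : ∀ s : Multiset ℝ, (s.map ((fun z ↦ 1 / (x - z)) ∘ Complex.ofRealHom)).sum.im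
        = -x.im * (s.map fun z : ℝ => 1 / Complex.normSq (x - z)).sum := by
      intro s
      induction s using Multiset.induction_on with
      | empty => simp
      | cons a s ih =>
        rw [Multiset.map_cons, Multiset.sum_cons, Complex.add_im, ih, Multiset.map_cons,
          Multiset.sum_cons]
        simp [Complex.inv_im]
        ring
    exact this _
  have hne : P.roots ≠ 0 := hP.roots_ne_zero h0
  obtain ⟨a, ha⟩ := Multiset.exists_mem_of_ne_zero hne
  obtain ⟨t, ht⟩ := Multiset.exists_cons_of_mem ha
  have hpos : ∀ b : ℝ, 0 < 1 / Complex.normSq (x - b) := by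
    intro b
    apply one_div_pos.2
    apply Complex.normSq_pos.2
    intro h
    apply him
    have := congrArg Complex.im h
    simpa using this
  have h5 : 0 < (P.roots.map fun z : ℝ => 1 / Complex.normSq (x - z)).sum := by
    rw [ht, Multiset.map_cons, Multiset.sum_cons]
    apply add_pos_of_pos_of_nonneg (hpos a)
    apply Multiset.sum_nonneg
    intro y hy
    rw [Multiset.mem_map] at hy
    obtain ⟨b, _, rfl⟩ := hy
    exact (hpos b).le
  rw [h4] at h3
  rcases mul_eq_zero.1 h3 with h | h
  · exact him (by linarith)
  · linarith

open Polynomial in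
theorem sq_laguerre_weak (P : ℝ[X]) (hP : P.Splits) (a : ℝ) :
    0 ≤ ((derivative P).eval a) ^ 2 - P.eval a * (derivative (derivative P)).eval a := by
  obtain ⟨m, hm⟩ := splits_iff_exists_multiset.1 hP
  generalize P.leadingCoeff = c at hm
  rw [hm]
  clear hm hP
  induction m using Multiset.induction_on with
  | empty => simp
  | cons b s ih =>
    rw [Multiset.map_cons, Multiset.prod_cons, mul_left_comm]
    generalize C c * (s.map fun a => X - C a).prod = Q at ih
    simp only [derivative_mul, derivative_sub, derivative_X, derivative_C, sub_zero, one_mul,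
      derivative_add, eval_add, eval_mul, eval_sub, eval_X, eval_C]
    nlinarith [sq_nonneg (Q.eval a), mul_nonneg (sq_nonneg (a - b)) ih]

open Polynomial in
theorem sq_laguerre (P : ℝ[X]) (hP : P.Splits) (hd : P.natDegree ≠ 0) (a : ℝ)
    (h : ¬ (P.eval a = 0 ∧ (derivative P).eval a = 0)) :
    0 < ((derivative P).eval a) ^ 2 - P.eval a * (derivative (derivative P)).eval a := by
  by_cases h0 : P.eval a = 0
  · have : (derivative P).eval a ≠ 0 := fun h' => h ⟨h0, h'⟩
    rw [h0, zero_mul, sub_zero]; positivity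
  have hP0 : P ≠ 0 := by rintro rfl; simp at hd
  obtain ⟨b, hb⟩ := hP.exists_eval_eq_zero (by
    intro h; exact hd (natDegree_eq_of_degree_eq_some h))
  obtain ⟨Q, rfl⟩ := dvd_iff_isRoot.2 hb
  have hQ : Q.Splits := splits_X_sub_C_mul_iff.1 hP
  have hw := sq_laguerre_weak Q hQ a
  have hQa : Q.eval a ≠ 0 := by
    intro h'; apply h0; simp [h']
  simp only [derivative_mul, derivative_sub, derivative_X, derivative_C, sub_zero, one_mul,
      derivative_add, eval_add, eval_mul, eval_sub, eval_X, eval_C]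
  have : 0 < (Q.eval a)^2 := by positivity
  nlinarith [mul_nonneg (sq_nonneg (a - b)) hw]

open Polynomial in
/-- iterate of `1 + ε ∂`. -/
noncomputable def sqT (ε : ℝ) (P : ℝ[X]) : ℕ → ℝ[X]
  | 0 => P
  | n + 1 => sqT ε P n + C ε * derivative (sqT ε P n)

open Polynomial in
theorem sqT_splits (ε : ℝ) (hε : 0 < ε) (P : ℝ[X]) (hP : P.Splits) (n : ℕ) :
    (sqT ε P n).Splits := by
  induction n with
  | zero => exact hP
  | succ n ih => simpa [sqT] using sq_splits_comb _ ih 1 ε hε.ne'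

open Polynomial in
theorem sqT_coeff_top (ε : ℝ) (P : ℝ[X]) (n d : ℕ) (hd : P.natDegree = d) :
    (sqT ε P n).natDegree ≤ d ∧ (sqT ε P n).coeff d = P.coeff d := by
  induction n with
  | zero => exact ⟨hd.le, rfl⟩
  | succ n ih =>
    have h1 : (derivative (sqT ε P n)).natDegree ≤ d :=
      (natDegree_derivative_le _).trans (by omega)
    refine ⟨?_, ?_⟩
    · exact natDegree_add_le_of_degree_le ih.1 ((natDegree_C_mul_le _ _).trans h1)
    · simp only [sqT, coeff_add, coeff_C_mul, ih.2, coeff_derivative]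
      rw [coeff_eq_zero_of_natDegree_lt (Nat.lt_succ_of_le ih.1)]
      simp

open Polynomial in
theorem sqT_natDegree (ε : ℝ) (P : ℝ[X]) (n : ℕ) :
    (sqT ε P n).natDegree = P.natDegree := by
  by_cases h0 : P = 0
  · have := (sqT_coeff_top ε P n _ rfl).1
    simp [h0] at this ⊢
    exact this
  · obtain ⟨h1, h2⟩ := sqT_coeff_top ε P n _ rfl
    apply le_antisymm h1
    apply le_natDegree_of_ne_zero
    rw [h2]
    simpa using h0

open Polynomial in
theorem sqT_derivative (ε : ℝ) (P : ℝ[X]) (n i : ℕ) :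
    derivative^[i] (sqT ε P n) = sqT ε (derivative^[i] P) n := by
  induction n with
  | zero => rfl
  | succ n ih =>
    simp only [sqT, iterate_map_add, iterate_derivative_C_mul, ← ih]
    rw [← Function.iterate_succ_apply, ← Function.iterate_succ_apply' derivative]

open Polynomial in
/-- no multiple roots after many applications -/
theorem sqT_simple (ε : ℝ) (hε : 0 < ε) (P : ℝ[X]) (hP : P.Splits) (hd : P.natDegree ≠ 0)
    (a : ℝ) (n : ℕ) :
    ∀ q : ℕ, (∀ i ≤ q + 1, (derivative^[i] (sqT ε P n)).eval a = 0) →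
      ∀ i ≤ q + 1 + n, (derivative^[i] P).eval a = 0 := by
  induction n with
  | zero => intro q h; exact h
  | succ n ih =>
    intro q h
    set U := sqT ε P n with hU
    have hrel : ∀ i, (derivative^[i] (sqT ε P (n+1))).eval a =
        (derivative^[i] U).eval a + ε * (derivative^[i+1] U).eval a := by
      intro i
      simp only [sqT, iterate_map_add, iterate_derivative_C_mul, eval_add, eval_mul, eval_C,
        ← hU, ← Function.iterate_succ_apply]
    have hU0 : U.eval a = 0 := by
      by_contra hne
      have hL := sq_laguerre U (sqT_splits ε hε P hP n) (by rw [hU, sqT_natDegree]; exact hd) a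
        (fun h' => hne h'.1)
      have e0 := h 0 (by omega)
      have e1 := h 1 (by omega)
      rw [hrel] at e0 e1
      simp at e0 e1
      set u0 := U.eval a
      set u1 := (derivative U).eval a
      set u2 := (derivative (derivative U)).eval a
      have : u0 = - ε * u1 := by linarith
      have h2 : u1 = - ε * u2 := by linarith
      have : u1 ^ 2 - u0 * u2 = 0 := by linear_combination u1 * e1 - u2 * e0
      linarith
    have key : ∀ i ≤ q + 2, (derivative^[i] U).eval a = 0 := by
      intro i
      induction i with
      | zero => intro _; exact hU0
      | succ i ihi =>
        intro hi
        have e := h i (by omega)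
        rw [hrel, ihi (by omega)] at e
        simpa [hε.ne'] using e
    intro i hi
    exact ih (q+1) key i (by omega)

open Polynomial in
theorem sqT_newton (ε : ℝ) (hε : 0 < ε) (P : ℝ[X]) (hP : P.Splits) (hd : P.natDegree ≠ 0)
    (n : ℕ) (hn : P.natDegree ≤ n) (a : ℝ) :
    0 < ((derivative (sqT ε P n)).eval a) ^ 2
      - (sqT ε P n).eval a * (derivative (derivative (sqT ε P n))).eval a := by
  apply sq_laguerre _ (sqT_splits ε hε P hP n) (by rw [sqT_natDegree]; exact hd)
  rintro ⟨h0, h1⟩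
  have := sqT_simple ε hε P hP hd a n 0 (by
    intro i hi
    interval_cases i
    · exact h0
    · exact h1) P.natDegree (by omega)
  have hc := coeff_iterate_derivative (k := P.natDegree) P 0
  have hdd : (derivative^[P.natDegree] P).natDegree = 0 := by
    have := natDegree_iterate_derivative P P.natDegree
    omega
  rw [eq_C_of_natDegree_eq_zero hdd, eval_C, hc] at this
  have hP0 : P ≠ 0 := by rintro rfl; simp at hd
  simp [Nat.factorial_ne_zero, hP0, Nat.descFactorial_self] at this

open Polynomial in
theorem sq_iter_splits (P : ℝ[X]) (hP : P.Splits) (i : ℕ) : (derivative^[i] P).Splits := by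
  induction i with
  | zero => exact hP
  | succ i ih =>
    rw [Function.iterate_succ_apply']
    simpa using sq_splits_comb _ ih 0 1 one_ne_zero

open Polynomial in
theorem sq_prod_of_alt (p : ℝ[X]) (n : ℕ) (hp : p.natDegree ≤ n) (a : ℕ → ℝ)
    (ha : ∀ i < n, a (i+1) < a i) (hs : ∀ i ≤ n, 0 < (-1 : ℝ) ^ i * p.eval (a i)) :
    ∃ η : ℕ → ℝ, (∀ i < n, a (i+1) < η i ∧ η i < a i ∧ p.eval (η i) = 0) ∧
      p = C (p.coeff n) * ∏ i ∈ Finset.range n, (X - C (η i)) := by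
  have h1 : ∀ i, ∃ x, i < n → a (i+1) < x ∧ x < a i ∧ p.eval x = 0 := by
    intro i
    by_cases hi : i < n
    · have hc : ContinuousOn (fun x => (-1 : ℝ)^i * p.eval x) (Set.Icc (a (i+1)) (a i)) := by
        fun_prop
      have := intermediate_value_Ioo (ha i hi).le hc
      have h0 : (0 : ℝ) ∈ Set.Ioo ((-1 : ℝ)^i * p.eval (a (i+1))) ((-1 : ℝ)^i * p.eval (a i)) := by
        refine ⟨?_, hs i hi.le⟩
        have := hs (i+1) hi
        rw [pow_succ] at this
        linarith
      obtain ⟨x, hx, hx0⟩ := this h0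
      refine ⟨x, fun _ => ⟨hx.1, hx.2, ?_⟩⟩
      simpa using hx0
    · exact ⟨0, fun h => absurd h hi⟩
  choose η hη using h1
  refine ⟨η, hη, ?_⟩
  have hanti : ∀ i j, i < j → j < n → η j < η i := by
    have hle : ∀ i j, i ≤ j → j ≤ n → a j ≤ a i := by
      intro i j hij
      induction j, hij using Nat.le_induction with
      | base => intro _; exact le_rfl
      | succ j hj ih => intro h; exact (ha j (by omega)).le.trans (ih (by omega))
    intro i j hij hj
    exact ((hη j hj).2.1.trans_le (hle (i+1) j hij hj.le)).trans (hη i (by omega)).1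
  have hinj : Set.InjOn η (Finset.range n) := by
    intro i hi j hj hij
    simp at hi hj
    rcases lt_trichotomy i j with h | h | h
    · have := hanti i j h hj; linarith
    · exact h
    · have := hanti j i h hi; linarith
  set R := ∏ i ∈ Finset.range n, (X - C (η i)) with hR
  have hRm : R.Monic := monic_prod_of_monic _ _ (fun i _ => monic_X_sub_C _)
  have hRd : R.natDegree = n := by
    rw [hR, natDegree_prod_of_monic _ _ (fun i _ => monic_X_sub_C _)]; simp
  rw [← sub_eq_zero]
  have hdle : (p - C (p.coeff n) * R).natDegree ≤ n := 
    (natDegree_sub_le _ _).trans (max_le hp ((natDegree_C_mul_le _ _).trans hRd.le))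
  apply eq_zero_of_degree_lt_of_eval_index_eq_zero (Finset.range n) (v := η) hinj
  · rw [Finset.card_range]
    have hc : (p - C (p.coeff n) * R).coeff n = 0 := by
      have : R.coeff n = 1 := by rw [← hRd]; exact hRm
      simp [this]
    rw [degree_lt_iff_coeff_zero]
    intro m hm
    rcases hm.eq_or_lt with h | h
    · rw [← h, hc]
    · exact coeff_eq_zero_of_natDegree_lt (by omega)
  · intro i hi
    have : R.eval (η i) = 0 := by
      rw [hR, eval_prod]
      exact Finset.prod_eq_zero hi (by simp)
    simp only [eval_sub, eval_mul, this, mul_zero, sub_zero]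
    exact (hη i (Finset.mem_range.1 hi)).2.2

theorem sq_sign_prod (ζ : ℕ → ℝ) (x : ℝ) (i j : ℕ) (hij : i ≤ j) (h1 : ∀ l < i, x < ζ l)
    (h2 : ∀ l, i ≤ l → l < j → ζ l < x) :
    0 < (-1 : ℝ)^i * ∏ l ∈ Finset.range j, (x - ζ l) := by
  rw [← Finset.prod_range_mul_prod_Ico _ hij, ← mul_assoc]
  have : (-1 : ℝ)^i * ∏ l ∈ Finset.range i, (x - ζ l) = ∏ l ∈ Finset.range i, (ζ l - x) := by
    rw [← Finset.card_range i, ← Finset.prod_const, Finset.card_range, ← Finset.prod_mul_distrib]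
    apply Finset.prod_congr rfl
    intros; ring
  rw [this]
  apply mul_pos
  · apply Finset.prod_pos
    intro l hl
    linarith [h1 l (Finset.mem_range.1 hl)]
  · apply Finset.prod_pos
    intro l hl
    rw [Finset.mem_Ico] at hl
    linarith [h2 l hl.1 hl.2]

open Polynomial in
theorem sq_neg_infty (p : ℝ[X]) (n : ℕ) (hn : 1 ≤ n) (hp : p.natDegree ≤ n) (hc : 0 < p.coeff n)
    (b : ℝ) : ∃ M < b, 0 < (-1 : ℝ)^n * p.eval M := by
  have hd : p.natDegree = n := le_antisymm hp (le_natDegree_of_ne_zero hc.ne')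
  set q := C ((-1 : ℝ)^n) * p.comp (-X) with hq
  have hqd : (p.comp (-X)).natDegree = n := by rw [natDegree_comp]; simp [hd]
  have hqdd : q.natDegree = n := by rw [hq, natDegree_C_mul (by simp), hqd]
  have hql : 0 < q.leadingCoeff := by
    rw [hq, leadingCoeff_mul, leadingCoeff_C, leadingCoeff_comp (by simp), hd]
    rw [leadingCoeff, hd]
    simp only [leadingCoeff_neg, leadingCoeff_X]
    have : ((-1 : ℝ)^n) * ((-1 : ℝ)^n) = 1 := by rw [← mul_pow]; simp
    nlinarith
  have ht := tendsto_atTop_of_leadingCoeff_nonneg q (by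
    rw [← natDegree_pos_iff_degree_pos, hqdd]; omega) hql.le
  obtain ⟨x, hx1, hx2⟩ := ((ht.eventually_gt_atTop 0).and
    (Filter.eventually_gt_atTop (-b))).exists
  refine ⟨-x, by linarith, ?_⟩
  simpa [hq] using hx1

open Polynomial in
theorem sq_sturm (w : ℕ → ℝ[X]) (k : ℕ) (h0 : w 0 = 1) (hdeg : ∀ j ≤ k, (w j).natDegree ≤ j)
    (hlead : ∀ j ≤ k, 0 < (w j).coeff j) (hzero : ∀ j ≤ k, 0 < (w j).eval 0)
    (hN : ∀ j, j + 2 ≤ k → ∀ z, (w (j+1)).eval z = 0 → (w j).eval z * (w (j+2)).eval z < 0) :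
    ∀ j ≤ k, ∃ ζ : ℕ → ℝ, (∀ i < j, ζ i < 0) ∧ (∀ i, i + 1 < j → ζ (i+1) < ζ i) ∧
      w j = C ((w j).coeff j) * ∏ i ∈ Finset.range j, (X - C (ζ i)) ∧
      (j + 1 ≤ k → ∀ i < j, 0 < (-1 : ℝ)^(i+1) * (w (j+1)).eval (ζ i)) := by
  intro j
  induction j with
  | zero => intro _; exact ⟨fun _ => 0, by simp, by simp, by simp [h0], by simp⟩
  | succ j ih =>
    intro hj
    obtain ⟨ζ, hneg, hanti, hprod, hnext⟩ := ih (by omega)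
    have hnext := hnext hj
    -- the points
    obtain ⟨M, hMb, hM⟩ := sq_neg_infty (w (j+1)) (j+1) (by omega) (hdeg _ hj) (hlead _ hj)
      (if j = 0 then 0 else ζ (j-1))
    set a : ℕ → ℝ := fun i => if i = 0 then 0 else if i = j + 1 then M else ζ (i-1) with ha
    have a0 : a 0 = 0 := by simp [ha]
    have aM : a (j+1) = M := by simp [ha]
    have aζ : ∀ i < j, a (i+1) = ζ i := by
      intro i hi
      simp [ha]
      intro h; omega
    have haa : ∀ i < j + 1, a (i+1) < a i := by
      intro i hi
      rcases Nat.lt_succ_iff_lt_or_eq.1 hi with h | h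
      · rw [aζ i h]
        cases i with
        | zero => rw [a0]; exact hneg 0 h
        | succ i => rw [aζ i (by omega)]; exact hanti i h
      · subst h
        rw [aM]
        cases i with
        | zero => rw [a0]; simpa using hMb
        | succ i => rw [aζ i (by omega)]; simpa using hMb
    have hsa : ∀ i ≤ j + 1, 0 < (-1 : ℝ)^i * (w (j+1)).eval (a i) := by
      intro i hi
      cases i with
      | zero => rw [a0]; simpa using hzero _ hj
      | succ i =>
        rcases Nat.lt_or_ge i j with h | h
        · rw [aζ i h]; exact hnext i h
        · have : i = j := by omega
          subst this
          rw [aM]; exact hM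
    obtain ⟨η, hη, hηp⟩ := sq_prod_of_alt (w (j+1)) (j+1) (hdeg _ hj) a haa hsa
    have hle : ∀ i l, i ≤ l → l ≤ j + 1 → a l ≤ a i := by
      intro i l hij
      induction l, hij using Nat.le_induction with
      | base => intro _; exact le_rfl
      | succ l hl ih => intro h; exact (haa l (by omega)).le.trans (ih (by omega))
    refine ⟨η, ?_, ?_, hηp, ?_⟩
    · intro i hi
      have := hle 0 i (by omega) hi.le
      rw [a0] at this
      exact (hη i hi).2.1.trans_le this
    · intro i hi
      exact (hη (i+1) hi).2.1.trans (hη i (by omega)).1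
    · intro hk i hi
      have hz := hN j hk (η i) (hη i hi).2.2
      have hpos : 0 < (-1 : ℝ)^i * (w j).eval (η i) := by
        rw [hprod, eval_mul, eval_C, eval_prod, mul_left_comm]
        apply mul_pos (hlead j (by omega))
        simp only [eval_sub, eval_X, eval_C]
        apply sq_sign_prod ζ (η i) i j (by omega)
        · intro l hl
          rw [← aζ l (by omega)]
          exact (hη i hi).2.1.trans_le (hle _ _ hl hi.le)
        · intro l hl hlj
          rw [← aζ l (by omega)]
          exact (hle _ _ (by omega) (by omega)).trans_lt (hη i hi).1
      rw [pow_succ]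
      have hsq : ((-1 : ℝ)^i) * ((-1 : ℝ)^i) = 1 := by rw [← mul_pow]; simp
      by_contra hcon
      push Not at hcon
      have : 0 ≤ ((-1 : ℝ)^i * (w j).eval (η i)) * ((-1 : ℝ)^i * (w (j+2)).eval (η i)) :=
        mul_nonneg hpos.le (by
          have e : (w (j+2)) = w (j+1+1) := rfl
          rw [e]; linarith)
      have e : ((-1 : ℝ)^i * (w j).eval (η i)) * ((-1 : ℝ)^i * (w (j+2)).eval (η i))
        = (((-1 : ℝ)^i) * ((-1 : ℝ)^i)) * ((w j).eval (η i) * (w (j+2)).eval (η i)) := by ring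
      rw [e, hsq] at this
      linarith

open Polynomial in
theorem sq_coeffs (c : ℝ) (hc : 0 < c) (k : ℕ) (ζ : ℕ → ℝ) (hζ : ∀ i < k, ζ i < 0) (p : ℝ[X])
    (hp : p = C c * ∏ i ∈ Finset.range k, (X - C (ζ i))) (s : ℕ) (hs : s ≤ k) :
    0 ≤ p.coeff s ∧ p.coeff 0 * p.coeff k ≤ p.coeff s * p.coeff (k - s) := by
  have hf : ∀ l ≤ k, p.coeff l = c * ∑ t ∈ (Finset.range k).powersetCard (k - l), ∏ i ∈ t, (-ζ i) := by
    intro l hl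
    rw [hp, coeff_C_mul]
    have : ∏ i ∈ Finset.range k, (X - C (ζ i)) = ∏ i ∈ Finset.range k, (X + C (-ζ i)) := by
      simp [sub_eq_add_neg]
    rw [this, Finset.prod_X_add_C_coeff _ _ (by simpa using hl), Finset.card_range]
  have hpos : ∀ t ⊆ Finset.range k, 0 ≤ ∏ i ∈ t, (-ζ i) := by
    intro t ht
    apply Finset.prod_nonneg
    intro i hi
    linarith [hζ i (Finset.mem_range.1 (ht hi))]
  have hge : ∀ l ≤ k, ∀ t ∈ (Finset.range k).powersetCard (k - l), c * ∏ i ∈ t, (-ζ i) ≤ p.coeff l := by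
    intro l hl t ht
    rw [hf l hl]
    apply mul_le_mul_of_nonneg_left _ hc.le
    exact Finset.single_le_sum (f := fun t => ∏ i ∈ t, (-ζ i))
      (fun u hu => hpos u (Finset.mem_powersetCard.1 hu).1) ht
  have hn : ∀ l ≤ k, 0 ≤ p.coeff l := by
    intro l hl
    rw [hf l hl]
    apply mul_nonneg hc.le
    exact Finset.sum_nonneg (fun u hu => hpos u (Finset.mem_powersetCard.1 hu).1)
  refine ⟨hn s hs, ?_⟩
  have e0 : p.coeff 0 = c * ∏ i ∈ Finset.range k, (-ζ i) := by
    rw [hf 0 (by omega), Nat.sub_zero]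
    conv_lhs => rw [show k = (Finset.range k).card by simp]
    rw [Finset.card_range, show (Finset.range k).powersetCard k = {Finset.range k} by
      conv_lhs => rw [show Finset.powersetCard k = Finset.powersetCard (Finset.range k).card by simp]
      exact Finset.powersetCard_self _]
    simp
  have ek : p.coeff k = c := by rw [hf k le_rfl]; simp
  rw [e0, ek]
  have h1 := hge s hs (Finset.range (k - s)) (by
    rw [Finset.mem_powersetCard]; refine ⟨?_, by simp⟩
    intro i; simp only [Finset.mem_range]; omega)
  have h2 := hge (k - s) (by omega) (Finset.Ico (k - s) k) (by
    rw [Finset.mem_powersetCard]; refine ⟨?_, by simp⟩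
    intro i; simp only [Finset.mem_range, Finset.mem_Ico]; omega)
  rw [← Finset.prod_range_mul_prod_Ico _ (show k - s ≤ k by omega)]
  have hA := hpos (Finset.range (k - s)) (by intro i; simp only [Finset.mem_range]; omega)
  have hB := hpos (Finset.Ico (k - s) k) (by
    intro i; simp only [Finset.mem_range, Finset.mem_Ico]; omega)
  calc _ = (c * ∏ i ∈ Finset.range (k - s), (-ζ i)) * (c * ∏ i ∈ Finset.Ico (k - s) k, (-ζ i)) := by ring
    _ ≤ _ := mul_le_mul h1 h2 (mul_nonneg hc.le hB) (hn s hs)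

open Polynomial in
/-- coefficients (in the spectral variable) of the perturbed family. -/
noncomputable def sqG (m : ℕ) (ε : ℝ) (g : ℕ → ℝ[X]) : ℕ → ℕ → ℝ[X]
  | 0, j => g j
  | n + 1, 0 => sqG m ε g n 0
  | n + 1, j + 1 => sqG m ε g n (j+1) + C (ε * ((m - j : ℕ) : ℝ)) * sqG m ε g n j

open Polynomial in
theorem sqG_zero (m : ℕ) (ε : ℝ) (g : ℕ → ℝ[X]) (n : ℕ) : sqG m ε g n 0 = g 0 := by
  induction n with
  | zero => rfl
  | succ n ih => exact ih

open Polynomial in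
theorem sqG_deg (m : ℕ) (ε : ℝ) (g : ℕ → ℝ[X]) (n : ℕ) (hd : ∀ j, (g j).natDegree ≤ j) :
    ∀ j, (sqG m ε g n j).natDegree ≤ j ∧ (sqG m ε g n j).coeff j = (g j).coeff j := by
  induction n with
  | zero => intro j; exact ⟨hd j, rfl⟩
  | succ n ih =>
    intro j
    cases j with
    | zero => exact ih 0
    | succ j =>
      refine ⟨?_, ?_⟩
      · exact natDegree_add_le_of_degree_le (ih _).1
          ((natDegree_C_mul_le _ _).trans ((ih j).1.trans (by omega)))
      · simp only [sqG, coeff_add, coeff_C_mul, (ih (j+1)).2]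
        rw [coeff_eq_zero_of_natDegree_lt (Nat.lt_succ_of_le (ih j).1)]
        simp

open Polynomial in
theorem sqG_pos (m : ℕ) (ε : ℝ) (hε : 0 < ε) (g : ℕ → ℝ[X]) (n k : ℕ)
    (h : ∀ j ≤ k, 0 < (g j).eval 0) :
    ∀ j ≤ k, 0 < (sqG m ε g n j).eval 0 := by
  induction n with
  | zero => exact h
  | succ n ih =>
    intro j hj
    cases j with
    | zero => exact ih 0 hj
    | succ j =>
      simp only [sqG, eval_add, eval_mul, eval_C]
      have h1 := ih (j+1) hj
      have h2 := ih j (by omega)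
      positivity

open Polynomial in
theorem sqG_cont (m : ℕ) (g : ℕ → ℝ[X]) (n : ℕ) (s : ℕ) :
    ∀ j, Continuous (fun ε : ℝ => (sqG m ε g n j).coeff s) := by
  induction n with
  | zero => intro j; exact continuous_const
  | succ n ih =>
    intro j
    cases j with
    | zero => exact ih 0
    | succ j =>
      simp only [sqG, coeff_add, coeff_C_mul]
      have h1 := ih (j+1)
      have h2 := ih j
      fun_prop

open Polynomial in
theorem sqG_at_zero (m : ℕ) (g : ℕ → ℝ[X]) (n : ℕ) :
    ∀ j, sqG m 0 g n j = g j := by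
  induction n with
  | zero => intro j; rfl
  | succ n ih =>
    intro j
    cases j with
    | zero => exact ih 0
    | succ j => simp [sqG, ih]

open Polynomial in
theorem sqG_eval (m : ℕ) (ε : ℝ) (g : ℕ → ℝ[X]) (z : ℝ) (Q : ℝ[X]) (hQ : Q.natDegree = m)
    (h : ∀ j ≤ m, Q.coeff (m - j) = (g j).eval z) (n : ℕ) :
    ∀ j ≤ m, (sqT ε Q n).coeff (m - j) = (sqG m ε g n j).eval z := by
  induction n with
  | zero => exact h
  | succ n ih =>
    intro j hj
    cases j with
    | zero =>
      rw [Nat.sub_zero, (sqT_coeff_top ε Q (n+1) m hQ).2, sqG_zero]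
      simpa using h 0 hj
    | succ j =>
      simp only [sqT, sqG, coeff_add, coeff_C_mul, eval_add, eval_mul, eval_C, coeff_derivative]
      rw [← ih (j+1) hj, ← ih j (by omega)]
      have e : m - (j+1) + 1 = m - j := by omega
      have e2 : ((m - (j+1) : ℕ) : ℝ) + 1 = ((m - j : ℕ) : ℝ) := by exact_mod_cast e
      rw [e, e2]
      ring

open Polynomial in
theorem sqG_newton (m : ℕ) (ε : ℝ) (hε : 0 < ε) (g : ℕ → ℝ[X]) (z : ℝ) (Q : ℝ[X])
    (hQ : Q.natDegree = m) (hQs : Q.Splits)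
    (h : ∀ j ≤ m, Q.coeff (m - j) = (g j).eval z) (j : ℕ) (hj : j + 2 ≤ m)
    (hz : (sqG m ε g m (j+1)).eval z = 0) :
    (sqG m ε g m j).eval z * (sqG m ε g m (j+2)).eval z < 0 := by
  have hE := sqG_eval m ε g z Q hQ h m
  obtain ⟨d, hd⟩ : ∃ d, d = m - (j+2) := ⟨_, rfl⟩
  set P := derivative^[d] Q with hP
  have hPs : P.Splits := sq_iter_splits Q hQs d
  have hQ0 : Q ≠ 0 := by rintro rfl; simp at hQ; omega
  have hPd : P.natDegree = j + 2 := by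
    apply le_antisymm
    · exact (natDegree_iterate_derivative Q d).trans (by omega)
    · apply le_natDegree_of_ne_zero
      rw [hP, coeff_iterate_derivative]
      have : j + 2 + d = Q.natDegree := by omega
      rw [this]
      simp only [coeff_natDegree, nsmul_eq_mul, ne_eq, mul_eq_zero, Nat.cast_eq_zero,
        leadingCoeff_eq_zero, hQ0, or_false]
      rw [Nat.descFactorial_eq_zero_iff_lt]
      omega
  have hN := sqT_newton ε hε P hPs (by omega) m (by omega) 0
  rw [← sqT_derivative, ← Function.iterate_succ_apply' derivative,
    ← Function.iterate_succ_apply' derivative] at hN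
  simp only [← coeff_zero_eq_eval_zero, coeff_iterate_derivative, zero_add] at hN
  rw [hd, hE (j+2) hj, show (m - (j+2)).succ = m - (j+1) by omega, hE (j+1) (by omega),
    show (m - (j+1)).succ = m - j by omega, hE j (by omega), hz] at hN
  simp only [Nat.descFactorial_self, nsmul_eq_mul, mul_zero] at hN
  have p1 : (0 : ℝ) < (m - (j+2)).factorial := by exact_mod_cast Nat.factorial_pos _
  have p2 : (0 : ℝ) < (m - j).factorial := by exact_mod_cast Nat.factorial_pos _
  by_contra hcon
  push Not at hcon
  have := mul_nonneg (mul_pos p1 p2).le hcon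
  nlinarith

open Polynomial in
theorem sq_main (m k : ℕ) (hk : k ≤ m) (g : ℕ → ℝ[X]) (h0 : g 0 = 1)
    (hd : ∀ j, (g j).natDegree ≤ j) (hl : ∀ j ≤ k, 0 < (g j).coeff j)
    (hz : ∀ j ≤ k, 0 < (g j).eval 0)
    (hQ : ∀ z : ℝ, ∃ Q : ℝ[X], Q.natDegree = m ∧ Q.Splits ∧
      ∀ j ≤ m, Q.coeff (m - j) = (g j).eval z) (s : ℕ) (hs : s ≤ k) :
    0 < (g k).coeff s := by
  have key : ∀ ε : ℝ, 0 < ε → ∀ s ≤ k, 0 ≤ (sqG m ε g m k).coeff s ∧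
      (sqG m ε g m k).coeff 0 * (sqG m ε g m k).coeff k ≤
        (sqG m ε g m k).coeff s * (sqG m ε g m k).coeff (k - s) := by
    intro ε hε s hs
    have hlead : ∀ j ≤ k, 0 < (sqG m ε g m j).coeff j := by
      intro j hj; rw [(sqG_deg m ε g m hd j).2]; exact hl j hj
    obtain ⟨ζ, h1, _, h2, _⟩ := sq_sturm (sqG m ε g m) k (by rw [sqG_zero, h0])
      (fun j _ => (sqG_deg m ε g m hd j).1) hlead (sqG_pos m ε hε g m k hz) (by
        intro j hj z hz0
        obtain ⟨Q, q1, q2, q3⟩ := hQ z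
        exact sqG_newton m ε hε g z Q q1 q2 q3 j (by omega) hz0) k le_rfl
    exact sq_coeffs _ (hlead k le_rfl) k ζ h1 _ h2 s hs
  have lim : ∀ t, Filter.Tendsto (fun ε : ℝ => (sqG m ε g m k).coeff t) (nhdsWithin 0 (Set.Ioi 0))
      (nhds ((g k).coeff t)) := by
    intro t
    have := ((sqG_cont m g m t k).tendsto 0).mono_left (nhdsWithin_le_nhds (s := Set.Ioi 0))
    simpa [sqG_at_zero] using this
  have hnn : 0 ≤ (g k).coeff s := by
    apply ge_of_tendsto (lim s)
    filter_upwards [self_mem_nhdsWithin] with ε hε using (key ε hε s hs).1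
  have hmul : (g k).coeff 0 * (g k).coeff k ≤ (g k).coeff s * (g k).coeff (k - s) := by
    apply le_of_tendsto_of_tendsto ((lim 0).mul (lim k)) ((lim s).mul (lim (k - s)))
    filter_upwards [self_mem_nhdsWithin] with ε hε using (key ε hε s hs).2
  have hp : 0 < (g k).coeff 0 * (g k).coeff k := by
    apply mul_pos _ (hl k le_rfl)
    rw [coeff_zero_eq_eval_zero]; exact hz k le_rfl
  rcases hnn.eq_or_lt with h | h
  · rw [← h, zero_mul] at hmul; linarith
  · exact h

open Polynomial in
theorem sq_sigmaM_map {m : ℕ} {R S : Type*} [CommRing R] [CommRing S] (f : R →+* S) (j : ℕ)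
    (W : Matrix (Fin m) (Fin m) R) : f (sigmaM j W) = sigmaM j (W.map f) := by
  unfold sigmaM
  rw [← coeff_map, ← coe_mapRingHom, RingHom.map_det]
  congr 2
  ext a b : 2
  by_cases h : a = b <;> simp [h, Matrix.one_apply]

open Polynomial in
theorem sq_sigmaM_zero {m : ℕ} {R : Type*} [CommRing R]
    (W : Matrix (Fin m) (Fin m) R) : sigmaM 0 W = 1 := by
  unfold sigmaM
  rw [coeff_zero_eq_eval_zero, ← coe_evalRingHom, RingHom.map_det]
  have : (evalRingHom (0 : R)).mapMatrix (1 + (X : R[X]) • W.map C) = 1 := by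
    ext a b : 2
    by_cases h : a = b <;> simp [h, Matrix.one_apply]
  rw [this, det_one]

open Polynomial in
theorem sq_sigmaM_charpoly {m : ℕ} (W : Matrix (Fin m) (Fin m) ℝ) (j : ℕ) (hj : j ≤ m) :
    (-W).charpoly.coeff (m - j) = sigmaM j W := by
  have h := Matrix.reverse_charpoly (-W)
  have h2 : sigmaM j W = (-W).charpolyRev.coeff j := by
    unfold sigmaM charpolyRev
    congr 2
    ext a b : 2
    simp
  rw [h2, ← h, coeff_reverse, revAt_le] <;> simp [hj]

open Polynomial in
/-- substitution `y ↦ y`, `ȳ ↦ y z`. -/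
noncomputable def sqPhi : ℝ[X][X] →+* ℝ[X][X] :=
  eval₂RingHom (eval₂RingHom ((C : ℝ[X] →+* ℝ[X][X]).comp C) (X * C X)) X

open Polynomial in
theorem sqPhi_coeff (E : ℝ[X][X]) (k s : ℕ) :
    ((sqPhi E).coeff k).coeff s = if s ≤ k then (E.coeff (k - s)).coeff s else 0 := by
  induction E using Polynomial.induction_on' with
  | add p q hp hq =>
    rw [map_add, coeff_add, coeff_add, hp, hq]
    split_ifs <;> simp
  | monomial n a =>
    induction a using Polynomial.induction_on' with
    | add p q hp hq =>
      rw [map_add, map_add, coeff_add, coeff_add, hp, hq]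
      split_ifs <;> simp
    | monomial l c =>
      have e : sqPhi (monomial n (monomial l c)) = monomial (n + l) (monomial l c) := by
        simp only [sqPhi, coe_eval₂RingHom, eval₂_monomial, RingHom.comp_apply]
        rw [mul_pow, ← C_pow, ← C_mul_X_pow_eq_monomial, ← C_mul_X_pow_eq_monomial, C_mul, pow_add]
        ring
      rw [e]
      simp only [coeff_monomial]
      split_ifs <;> first | omega | simp_all [coeff_monomial]
      all_goals (intro h; omega)

open Polynomial in
theorem sqPhi_det {m : ℕ} (A B : Matrix (Fin m) (Fin m) ℝ) :
    sqPhi ((1 : Matrix (Fin m) (Fin m) ℝ[X][X])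
        + (X : ℝ[X][X]) • A.map (fun a => C (C a))
        + (C X : ℝ[X][X]) • B.map (fun a => C (C a))).det
      = (1 + (X : ℝ[X][X]) • (A.map C + (X : ℝ[X]) • B.map C).map C).det := by
  rw [RingHom.map_det]
  congr 1
  ext1 a b
  by_cases h : a = b <;> simp [h, Matrix.one_apply, sqPhi] <;> ring

/-- if `χ, χ̄` both lie in the Gårding cone `Γ_{r+s}`, then `P_{r,s}(χ,χ̄) > 0`. -/
theorem statement4 (n r s : ℕ) (hn : 2 ≤ n) (hrs1 : 1 ≤ r + s) (hrs2 : r + s ≤ n - 1)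
    (χ χb : Matrix (Fin (n-1)) (Fin (n-1)) ℝ) (hχ : χ.IsSymm) (hχb : χb.IsSymm)
    (hG : matGamma (r+s) χ) (hGb : matGamma (r+s) χb) :
    0 < mixedP r s χ χb := by
  generalize n - 1 = m at *
  unfold mixedP
  apply mul_pos (by positivity)
  set E := ((1 : Matrix (Fin m) (Fin m) (Polynomial (Polynomial ℝ)))
        + (Polynomial.X : Polynomial (Polynomial ℝ)) •
            χ.map (fun a => Polynomial.C (Polynomial.C a))
        + (Polynomial.C Polynomial.X : Polynomial (Polynomial ℝ)) •
            χb.map (fun a => Polynomial.C (Polynomial.C a))).det with hE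
  set N := χ.map Polynomial.C + (Polynomial.X : Polynomial ℝ) • χb.map Polynomial.C with hN
  have hcoef : ∀ j t, (sigmaM j N).coeff t = if t ≤ j then (E.coeff (j - t)).coeff t else 0 := by
    intro j t
    rw [← sqPhi_coeff, hE, sqPhi_det]
    rfl
  have heval : ∀ z j, (sigmaM j N).eval z = sigmaM j (χ + z • χb) := by
    intro z j
    rw [← Polynomial.coe_evalRingHom, sq_sigmaM_map]
    congr 1
    ext a b
    simp [hN]
    ring
  have hlead : ∀ j, (sigmaM j N).coeff j = sigmaM j χb := by
    intro j
    rw [hcoef, if_pos le_rfl, Nat.sub_self, Polynomial.coeff_zero_eq_eval_zero, hE,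
      ← Polynomial.coe_evalRingHom, RingHom.map_det]
    unfold sigmaM
    congr 2
    ext1 a b
    by_cases h : a = b <;> simp [h, Matrix.one_apply]
  have hmain := sq_main m (r+s) hrs2 (fun j => sigmaM j N) (sq_sigmaM_zero N)
    (by
      intro j
      rw [Polynomial.natDegree_le_iff_coeff_eq_zero]
      intro t ht
      rw [hcoef, if_neg (by omega)])
    (by
      intro j hj
      rw [hlead]
      rcases Nat.eq_zero_or_pos j with h | h
      · rw [h, sq_sigmaM_zero]; exact one_pos
      · exact hGb j h hj)
    (by
      intro j hj
      rw [heval, zero_smul, add_zero]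
      rcases Nat.eq_zero_or_pos j with h | h
      · rw [h, sq_sigmaM_zero]; exact one_pos
      · exact hG j h hj)
    (by
      intro z
      refine ⟨(-(χ + z • χb)).charpoly, by simp, ?_, ?_⟩
      · apply Matrix.IsHermitian.splits_charpoly
        have hs : (-(χ + z • χb)).IsSymm := (hχ.add (hχb.smul z)).neg
        rw [Matrix.IsHermitian, Matrix.conjTranspose_eq_transpose_of_trivial]
        exact hs
      · intro j hj
        rw [sq_sigmaM_charpoly _ j hj, heval])
    s (by omega)
  rw [hcoef, if_pos (by omega), Nat.add_sub_cancel] at hmain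
  exact hmain
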